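/- For all r, k with 0 < r ≤ |S| and 0 < k < |A|^{|S|} and |A|^{|S|−r} dividing k, there exists a local map μ : A^S → A with |MN(μ)| = r and α(μ) = k. -/

import Mathlib

open Classical in
/-- The general construction. -/
theorem stmt14_aux (A S : Type*) [Fintype A] [Fintype S] [DecidableEq S] (e : S)
    (R : Finset S) (he : e ∈ R) (T : Finset ({s // s ∈ R} → A)) (σ : A → A)
    (hσ : ∀ a, σ a ≠ a) (μ : (S → A) → A)
    (hμ : ∀ z, μ z = if (fun s : {s // s ∈ R} => z s) ∈ T then σ (z e) else z e)
    (hess : ∀ s ∈ R, ∃ z w : S → A, (∀ t, t ≠ s → z t = w t) ∧ μ z ≠ μ w) :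
    Nat.card {s : S | ∃ z w : S → A, (∀ t, t ≠ s → z t = w t) ∧ μ z ≠ μ w} = R.card ∧
      Nat.card {z : S → A // μ z ≠ z e} =
        T.card * Fintype.card A ^ (Fintype.card S - R.card) := by
  constructor
  · have : {s : S | ∃ z w : S → A, (∀ t, t ≠ s → z t = w t) ∧ μ z ≠ μ w} = (R : Set S) := by
      ext s
      simp only [Set.mem_ofPred_eq, Finset.mem_coe]
      refine ⟨?_, hess s⟩
      rintro ⟨z, w, h, hne⟩
      by_contra hs
      apply hne
      have h1 : (fun s : {s // s ∈ R} => z s) = (fun s : {s // s ∈ R} => w s) := by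
        funext t
        apply h
        rintro rfl
        exact hs t.2
      have h2 : z e = w e := h e (by rintro rfl; exact hs he)
      rw [hμ, hμ, h1, h2]
    rw [this]
    simp
  · have h1 : ∀ z, μ z ≠ z e ↔ (fun s : {s // s ∈ R} => z s) ∈ T := by
      intro z
      rw [hμ]
      split_ifs with h
      · simp [h, hσ]
      · simp [h]
    let E := Equiv.piEquivPiSubtypeProd (fun s => s ∈ R) (fun _ : S => A)
    have E2 : {z : S → A // μ z ≠ z e} ≃ {x : ({s // s ∈ R} → A) × ({s // s ∉ R} → A) // x.1 ∈ T} :=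
      E.subtypeEquiv (by intro z; rw [h1]; rfl)
    have E3 : {x : ({s // s ∈ R} → A) × ({s // s ∉ R} → A) // x.1 ∈ T} ≃
        {x // x ∈ T} × ({s // s ∉ R} → A) :=
      { toFun := fun x => (⟨x.1.1, x.2⟩, x.1.2)
        invFun := fun y => ⟨(y.1.1, y.2), y.1.2⟩
        left_inv := fun _ => rfl
        right_inv := fun _ => rfl }
    rw [Nat.card_congr (E2.trans E3), Nat.card_prod]
    have h3 : Nat.card {s // s ∉ R} = Fintype.card S - R.card := by
      rw [Nat.card_eq_fintype_card, Fintype.card_subtype_compl]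
      simp
    rw [Nat.card_fun, h3]
    simp

/-- Counting for the projection to another coordinate. -/
theorem stmt14_proj (A S : Type*) [Fintype A] [Fintype S] [DecidableEq S]
    (e t : S) (hte : e ≠ t) :
    Nat.card {z : S → A // z t ≠ z e} =
      (Fintype.card A - 1) * Fintype.card A ^ (Fintype.card S - 1) := by
  classical
  have E : {z : S → A // z t = z e} ≃ ({s // s ≠ t} → A) :=
    { toFun := fun z s => z.1 s
      invFun := fun y => ⟨fun s => if h : s ≠ t then y ⟨s, h⟩ else y ⟨e, hte⟩, by simp [hte]⟩
      left_inv := by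
        rintro ⟨z, hz⟩
        ext s
        by_cases h : s = t
        · subst h; simp [hz]
        · simp [h]
      right_inv := by
        intro y
        funext s
        simp [s.2] }
  have h1 : Fintype.card {z : S → A // z t = z e} = Fintype.card A ^ (Fintype.card S - 1) := by
    rw [Fintype.card_congr E, Fintype.card_fun, Fintype.card_subtype_compl]
    simp
  have h2 := Fintype.card_subtype_compl (fun z : S → A => z t = z e)
  rw [Nat.card_eq_fintype_card]
  have h3 : Fintype.card {z : S → A // z t ≠ z e} = Fintype.card {z : S → A // ¬ z t = z e} := rfl
  rw [h3, h2, h1, Fintype.card_fun, Nat.sub_mul, one_mul, ← pow_succ']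
  have : 0 < Fintype.card S := Fintype.card_pos_iff.2 ⟨e⟩
  congr 2
  omega

/-- For all `0 < r ≤ |S|` and `0 < k < |A|^{|S|}` with `|A|^{|S|-r} ∣ k`, there
is a local map `μ : A^S → A` with `|MN(μ)| = r` and `α(μ) = k`. -/
theorem stmt14 (A S : Type*) [Fintype A] [Fintype S] [DecidableEq S]
    (hA : 2 ≤ Fintype.card A) (hS : 2 ≤ Fintype.card S) (e : S)
    (r k : ℕ) (hr0 : 0 < r) (hr : r ≤ Fintype.card S)
    (hk0 : 0 < k) (hk : k < Fintype.card A ^ Fintype.card S)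
    (hdvd : Fintype.card A ^ (Fintype.card S - r) ∣ k) :
    ∃ μ : (S → A) → A,
      Nat.card {s : S | ∃ z w : S → A, (∀ t, t ≠ s → z t = w t) ∧ μ z ≠ μ w} = r ∧
      Nat.card {z : S → A // μ z ≠ z e} = k := by
  classical
  obtain ⟨j, rfl⟩ := hdvd
  have hj0 : 0 < j := Nat.pos_of_mul_pos_left hk0
  have hj : j < Fintype.card A ^ r := by
    have h : Fintype.card A ^ Fintype.card S
        = Fintype.card A ^ (Fintype.card S - r) * Fintype.card A ^ r := by
      rw [← pow_add]; congr 1; omega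
    rw [h] at hk
    exact lt_of_mul_lt_mul_left hk (Nat.zero_le _)
  obtain ⟨a, b, hab⟩ := Fintype.exists_pair_of_one_lt_card (α := A) (by omega)
  let σ : A → A := fun x => if x = a then b else a
  have hσ : ∀ x, σ x ≠ x := by
    intro x
    simp only [σ]
    split_ifs with h
    · rw [h]; exact hab.symm
    · exact fun h' => h h'.symm
  obtain ⟨R, heR, -, hRc⟩ := Finset.exists_subsuperset_card_eq
    (s := {e}) (t := Finset.univ) (n := r) (Finset.subset_univ _) (by rw [Finset.card_singleton]; omega)
    (by simpa using hr)
  have he : e ∈ R := heR (Finset.mem_singleton_self e)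
  have hcard : Fintype.card ({s // s ∈ R} → A) = Fintype.card A ^ r := by
    simp [hRc]
  -- restriction
  let ρ : (S → A) → ({s // s ∈ R} → A) := fun z s => z s
  suffices hmain : (∃ T : Finset ({s // s ∈ R} → A), T.card = j ∧ ∀ s ∈ R, ∃ z w : S → A,
      (∀ t, t ≠ s → z t = w t) ∧
        (if ρ z ∈ T then σ (z e) else z e) ≠ (if ρ w ∈ T then σ (w e) else w e)) ∨
      (r = 1 ∧ j = Fintype.card A - 1) by
    rcases hmain with ⟨T, hT, hess⟩ | ⟨rfl, rfl⟩
    · refine ⟨fun z => if ρ z ∈ T then σ (z e) else z e, ?_⟩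
      have := stmt14_aux A S e R he T σ hσ (fun z => if ρ z ∈ T then σ (z e) else z e)
        (fun z => rfl) hess
      rw [hRc, hT] at this
      rw [mul_comm]
      exact this
    · obtain ⟨t, hte⟩ := Fintype.exists_ne_of_one_lt_card (by omega) e
      refine ⟨fun z => z t, ?_, ?_⟩
      · have : {s : S | ∃ z w : S → A, (∀ t, t ≠ s → z t = w t) ∧ z t ≠ w t} = {t} := by
          ext s
          simp only [Set.mem_ofPred_eq, Set.mem_singleton_iff]
          constructor
          · rintro ⟨z, w, h, hne⟩
            by_contra hs
            exact hne (h t (Ne.symm hs))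
          · rintro rfl
            exact ⟨fun _ => a, Function.update (fun _ => a) s b,
              fun t ht => by simp [ht], by simpa using hab⟩
        rw [this]
        simp
      · rw [stmt14_proj A S e t hte.symm, mul_comm]
  by_cases hr1 : r = 1
  · by_cases hjq : j = Fintype.card A - 1
    · exact Or.inr ⟨hr1, hjq⟩
    left
    rw [hr1, pow_one] at hj hcard
    have hne : ρ (fun _ => a) ≠ ρ (fun _ => b) := fun h => hab (congrFun h ⟨e, he⟩)
    obtain ⟨T, hTs, hT⟩ := Finset.exists_subset_card_eq
      (s := ({ρ (fun _ => a), ρ (fun _ => b)} : Finset _)ᶜ) (n := j) (by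
        rw [Finset.card_compl, Finset.card_pair hne, hcard]; omega)
    refine ⟨T, hT, ?_⟩
    have h1 : ρ (fun _ => a) ∉ T := fun h => by simpa using hTs h
    have h2 : ρ (fun _ => b) ∉ T := fun h => by simpa using hTs h
    have hRe : R = {e} := by
      symm
      apply Finset.eq_of_subset_of_card_le heR
      simp [hRc, hr1]
    intro s hs
    have hse : s = e := by rw [hRe] at hs; simpa using hs
    subst hse
    have h3 : ρ (Function.update (fun _ => a) s b) = ρ (fun _ => b) := by
      funext x
      have : (x : S) = s := by
        have hx : ∀ y ∈ R, y = s := fun y hy => by rw [hRe] at hy; simpa using hy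
        exact hx x x.2
      simp [ρ, this]
    refine ⟨fun _ => a, Function.update (fun _ => a) s b, fun t ht => by simp [ht], ?_⟩
    rw [h3, if_neg h1, if_neg h2]
    simpa using hab
  · left
    obtain ⟨t0, ht0R, ht0⟩ := Finset.exists_mem_ne (s := R) (by omega) e
    let p : S → A := fun _ => a
    let P : S → S → A := fun t => Function.update p t b
    let Q : S → A := Function.update (P t0) e b
    let N : Finset ({s // s ∈ R} → A) := insert (ρ Q) ((R.erase e).image (fun t => ρ (P t)))
    have hN : N.card ≤ r := by
      refine (Finset.card_insert_le _ _).trans ?_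
      have := Finset.card_image_le (s := R.erase e) (f := fun t => ρ (P t))
      rw [Finset.card_erase_of_mem he] at this
      omega
    have hpN : ρ p ∉ N := by
      simp only [N, Finset.mem_insert, Finset.mem_image, Finset.mem_erase, not_or, not_exists,
        not_and]
      refine ⟨fun h => ?_, fun t ht h => ?_⟩
      · have := congrFun h ⟨e, he⟩
        simp [ρ, p, Q] at this
        exact hab this
      · have := congrFun h ⟨t, ht.2⟩
        simp [ρ, p, P] at this
        exact hab this.symm
    have hT : ∃ T : Finset ({s // s ∈ R} → A), T.card = j ∧ ∀ x ∈ N, (x ∈ T ↔ ρ p ∉ T) := by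
      have hpow : 2 * r ≤ Fintype.card A ^ r := by
        have h1 : 2 ^ r ≤ Fintype.card A ^ r := Nat.pow_le_pow_left hA r
        have h2 : r - 1 < 2 ^ (r - 1) := Nat.lt_two_pow_self
        have h3 : 2 ^ r = 2 * 2 ^ (r - 1) := by
          rw [← pow_succ']; congr 1; omega
        omega
      by_cases hjr : r ≤ j
      · obtain ⟨T, hNT, hTp, hT⟩ := Finset.exists_subsuperset_card_eq
          (s := N) (t := {ρ p}ᶜ) (n := j)
          (fun x hx => by
            simp only [Finset.mem_compl, Finset.mem_singleton]
            rintro rfl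
            exact hpN hx) (by omega) (by
            rw [Finset.card_compl, hcard, Finset.card_singleton]; omega)
        have : ρ p ∉ T := fun h => by simpa using hTp h
        exact ⟨T, hT, fun x hx => by simp [hNT hx, this]⟩
      · obtain ⟨T, hpT, hTN, hT⟩ := Finset.exists_subsuperset_card_eq
          (s := {ρ p}) (t := Nᶜ) (n := j)
          (by simpa using hpN) (by rw [Finset.card_singleton]; omega) (by
            rw [Finset.card_compl, hcard]; omega)
        have : ρ p ∈ T := hpT (Finset.mem_singleton_self _)
        refine ⟨T, hT, fun x hx => ?_⟩
        have hx' : x ∉ T := fun h => by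
          have := hTN h
          rw [Finset.mem_compl] at this
          exact this hx
        simp [hx', this]
    obtain ⟨T, hT, hiff⟩ := hT
    refine ⟨T, hT, fun s hs => ?_⟩
    have hP : ∀ t ∈ R, t ≠ e → (ρ (P t) ∈ T ↔ ρ p ∉ T) := fun t ht hte => by
      apply hiff
      apply Finset.mem_insert_of_mem
      exact Finset.mem_image_of_mem (fun t => ρ (P t)) (Finset.mem_erase.2 ⟨hte, ht⟩)
    have hQ : ρ Q ∈ T ↔ ρ p ∉ T := hiff _ (Finset.mem_insert_self _ _)
    have hpe : p e = a := rfl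
    have hPe : ∀ t, t ≠ e → P t e = a := fun t ht => by simp [P, p, ht.symm]
    have hQe : Q e = b := by simp [Q]
    have hσa : σ a = b := by simp [σ]
    have hσb : σ b = a := by simp [σ, hab.symm]
    by_cases hse : s = e
    · subst hse
      refine ⟨P t0, Q, fun t ht => by simp [Q, ht], ?_⟩
      simp only [hP t0 ht0R ht0, hQ, hPe t0 ht0, hQe, hσa, hσb]
      split_ifs
      · exact hab
      · exact hab.symm
    · refine ⟨p, P s, fun t ht => by simp [P, ht], ?_⟩
      simp only [hP s hs hse, hPe s hse, hpe, hσa]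
      by_cases h : ρ p ∈ T
      · simpa [h] using hab.symm
      · simpa [h] using hab
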